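/- arXiv:2310.18238 — 8 statements merged into one kernel-verified Lean document; each statement's English description precedes it below -/
import Mathlib

section
/- Let a, b, c, d, o be points of the Euclidean plane ℝ² and let r be a real number with dist o a = r, dist o b = r, dist o c = r (so a, b, c lie on a common circle with center o and radius r), and b ≠ c. If dist o d > r (d is strictly outside this circle) and a and d lie strictly on opposite sides of the line through b and c, then ∠ b a c + ∠ b d c < π. -/
open EuclideanGeometry Real

/-- The cross product of `x - p` and `y - p`: twice the signed area of the triangle `p x y`. -/
def signedArea (p x y : EuclideanSpace ℝ (Fin 2)) : ℝ :=
  (x 0 - p 0) * (y 1 - p 1) - (x 1 - p 1) * (y 0 - p 0)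

theorem dist_sq_eq_coord (x y : EuclideanSpace ℝ (Fin 2)) :
    dist x y ^ 2 = (x 0 - y 0) ^ 2 + (x 1 - y 1) ^ 2 := by
  rw [EuclideanSpace.dist_sq_eq]
  simp [Fin.sum_univ_two, Real.dist_eq, sq_abs]

theorem cos_angle_mul_dist_mul_dist (x p y : EuclideanSpace ℝ (Fin 2)) :
    Real.cos (∠ x p y) * (dist x p * dist y p) =
      (x 0 - p 0) * (y 0 - p 0) + (x 1 - p 1) * (y 1 - p 1) := by
  rw [EuclideanGeometry.angle, dist_eq_norm_vsub (EuclideanSpace ℝ (Fin 2)) x,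
    dist_eq_norm_vsub (EuclideanSpace ℝ (Fin 2)) y,
    InnerProductGeometry.cos_angle_mul_norm_mul_norm]
  simp [PiLp.inner_apply, Fin.sum_univ_two]
  ring

theorem sin_angle_mul_dist_mul_dist (x p y : EuclideanSpace ℝ (Fin 2)) :
    Real.sin (∠ x p y) * (dist x p * dist y p) = |signedArea p x y| := by
  have hsin : 0 ≤ Real.sin (∠ x p y) := InnerProductGeometry.sin_angle_nonneg _ _
  rw [← abs_of_nonneg (show 0 ≤ Real.sin (∠ x p y) * (dist x p * dist y p) by positivity),
    ← sq_eq_sq_iff_abs_eq_abs, mul_pow, Real.sin_sq, sub_mul, ← mul_pow,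
    cos_angle_mul_dist_mul_dist, mul_pow, dist_sq_eq_coord, dist_sq_eq_coord, signedArea]
  ring

theorem signedArea_ne_zero_of_notMem_line {b c p : EuclideanSpace ℝ (Fin 2)} (hbc : b ≠ c)
    (hp : p ∉ affineSpan ℝ {b, c}) : signedArea p b c ≠ 0 := by
  intro h
  apply hp
  rw [signedArea] at h
  have hcoord : c 0 - b 0 ≠ 0 ∨ c 1 - b 1 ≠ 0 := by
    by_contra! h'
    apply hbc
    ext i
    fin_cases i
    · exact (sub_eq_zero.mp h'.1).symm
    · exact (sub_eq_zero.mp h'.2).symm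
  rw [mem_affineSpan_pair_iff_exists_lineMap_eq]
  rcases hcoord with h0 | h1
  · refine ⟨(p 0 - b 0) / (c 0 - b 0), ?_⟩
    ext i
    fin_cases i <;> simp [AffineMap.lineMap_apply] <;> field_simp <;> linarith
  · refine ⟨(p 1 - b 1) / (c 1 - b 1), ?_⟩
    ext i
    fin_cases i <;> simp [AffineMap.lineMap_apply] <;> field_simp <;> linarith

theorem signedArea_mul_signedArea_neg {a b c d : EuclideanSpace ℝ (Fin 2)} (hbc : b ≠ c)
    (h : (affineSpan ℝ {b, c}).SOppSide a d) : signedArea a b c * signedArea d b c < 0 := by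
  have ha := signedArea_ne_zero_of_notMem_line hbc h.left_notMem
  obtain ⟨ha', hd', q, hq, hray⟩ :=
    (AffineSubspace.sOppSide_iff_exists_left (left_mem_affineSpan_pair ℝ b c)).mp h
  have hab : a -ᵥ b ≠ 0 := fun h0 ↦
    ha' (vsub_eq_zero_iff_eq.mp h0 ▸ left_mem_affineSpan_pair ℝ b c)
  have hqd : q -ᵥ d ≠ 0 := fun h0 ↦ hd' (vsub_eq_zero_iff_eq.mp h0 ▸ hq)
  obtain ⟨s, t, hs, ht, hst⟩ := hray.exists_pos hab hqd
  obtain ⟨k, rfl⟩ := mem_affineSpan_pair_iff_exists_lineMap_eq.mp hq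
  have h0 := congrArg (fun v : EuclideanSpace ℝ (Fin 2) ↦ v 0) hst
  have h1 := congrArg (fun v : EuclideanSpace ℝ (Fin 2) ↦ v 1) hst
  simp [AffineMap.lineMap_apply] at h0 h1
  have key : s * signedArea a b c = -(t * signedArea d b c) := by
    simp only [signedArea]
    linear_combination (b 1 - c 1) * h0 - (b 0 - c 0) * h1
  have hprod : t * (signedArea a b c * signedArea d b c) = -(s * signedArea a b c ^ 2) := by
    linear_combination signedArea a b c * key
  have hneg : t * (signedArea a b c * signedArea d b c) < 0 := by
    rw [hprod]
    exact neg_neg_of_pos (by positivity)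
  exact (pos_iff_neg_of_mul_neg hneg).mp ht

/-- The power of `d` with respect to the circle through `a`, `b`, `c`, scaled by `signedArea`. -/
theorem signedArea_mul_power {a b c d o : EuclideanSpace ℝ (Fin 2)} {r : ℝ}
    (ha : dist o a = r) (hb : dist o b = r) (hc : dist o c = r) :
    signedArea a b c * (dist o d ^ 2 - r ^ 2) =
      signedArea a b c * ((b 0 - d 0) * (c 0 - d 0) + (b 1 - d 1) * (c 1 - d 1)) -
      signedArea d b c * ((b 0 - a 0) * (c 0 - a 0) + (b 1 - a 1) * (c 1 - a 1)) := by
  have ha' := congrArg (· ^ 2) ha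
  have hb' := congrArg (· ^ 2) hb
  have hc' := congrArg (· ^ 2) hc
  simp only [dist_sq_eq_coord] at ha' hb' hc' ⊢
  linear_combination (norm := (simp only [signedArea]; ring)) signedArea d b c * ha' +
    signedArea d c a * hb' + signedArea d a b * hc'

theorem ww_opposite_angles_sum_lt_pi
    (a b c d o : EuclideanSpace ℝ (Fin 2)) (r : ℝ)
    (ha : dist o a = r) (hb : dist o b = r) (hc : dist o c = r)
    (hbc : b ≠ c)
    (hd : dist o d > r)
    (hside : AffineSubspace.SOppSide (affineSpan ℝ {b, c}) a d) :
    ∠ b a c + ∠ b d c < π := by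
  have hneg := signedArea_mul_signedArea_neg hbc hside
  have hpow := signedArea_mul_power (d := d) ha hb hc
  have hr : 0 ≤ r := ha ▸ dist_nonneg
  have hpos : 0 < dist o d ^ 2 - r ^ 2 := by nlinarith
  have hsin : 0 < Real.sin (∠ b a c + ∠ b d c) *
      ((dist b a * dist c a) * (dist b d * dist c d)) := by
    have expand : Real.sin (∠ b a c + ∠ b d c) *
        ((dist b a * dist c a) * (dist b d * dist c d)) =
        |signedArea a b c| * ((b 0 - d 0) * (c 0 - d 0) + (b 1 - d 1) * (c 1 - d 1)) +
        ((b 0 - a 0) * (c 0 - a 0) + (b 1 - a 1) * (c 1 - a 1)) * |signedArea d b c| := by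
      rw [← sin_angle_mul_dist_mul_dist, ← sin_angle_mul_dist_mul_dist,
        ← cos_angle_mul_dist_mul_dist, ← cos_angle_mul_dist_mul_dist, Real.sin_add]
      ring
    rw [expand]
    rcases mul_neg_iff.mp hneg with ⟨h1, h2⟩ | ⟨h1, h2⟩
    · rw [abs_of_pos h1, abs_of_neg h2]
      nlinarith [mul_pos h1 hpos]
    · rw [abs_of_neg h1, abs_of_pos h2]
      nlinarith [mul_neg_of_neg_of_pos h1 hpos]
  have hsin' := pos_of_mul_pos_left hsin (by positivity)
  by_contra! hge
  have hle : ∠ b a c + ∠ b d c ≤ 2 * π := by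
    linarith [EuclideanGeometry.angle_le_pi b a c, EuclideanGeometry.angle_le_pi b d c]
  have := Real.sin_nonneg_of_nonneg_of_le_pi (x := ∠ b a c + ∠ b d c - π)
    (by linarith) (by linarith)
  rw [Real.sin_sub_pi] at this
  linarith
end

section
/- Let a, b, c, d, o be points of the Euclidean plane ℝ² and let r be a real number with dist o a = r, dist o b = r, dist o c = r (so a, b, c lie on a common circle with center o and radius r), and b ≠ c. If dist o d > r (d is strictly outside this circle) and a and d lie strictly on the same side of the line through b and c, then ∠ b d c < ∠ b a c. -/
open EuclideanGeometry Real

/-- Twice the signed area of the triangle with vertices `x`, `b`, `c`. -/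
def doubleSignedArea (x b c : EuclideanSpace ℝ (Fin 2)) : ℝ :=
  (b 0 - x 0) * (c 1 - x 1) - (b 1 - x 1) * (c 0 - x 0)

lemma sin_angle_mul_dist_mul_dist_eq_abs_doubleSignedArea
    (x b c : EuclideanSpace ℝ (Fin 2)) :
    sin (∠ b x c) * (‖b - x‖ * ‖c - x‖) = |doubleSignedArea x b c| := by
  have h := InnerProductGeometry.sin_angle_mul_norm_mul_norm (b - x) (c - x)
  rw [EuclideanGeometry.angle, vsub_eq_sub, vsub_eq_sub, h, ← sqrt_sq_eq_abs]
  congr 1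
  simp only [PiLp.inner_apply, Fin.sum_univ_two, PiLp.sub_apply, RCLike.inner_apply,
    conj_trivial, doubleSignedArea]
  ring

/-- The affine interpolation identity behind the inscribed angle comparison. -/
lemma doubleSignedArea_mul_inner_sub_inner_mul_doubleSignedArea
    {a b c d o : EuclideanSpace ℝ (Fin 2)} {r : ℝ}
    (ha : dist o a = r) (hb : dist o b = r) (hc : dist o c = r) :
    doubleSignedArea a b c * inner ℝ (b - d) (c - d) -
      inner ℝ (b - a) (c - a) * doubleSignedArea d b c =
      doubleSignedArea a b c * (dist o d ^ 2 - r ^ 2) := by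
  have sq (x : EuclideanSpace ℝ (Fin 2)) :
      dist o x ^ 2 = (o 0 - x 0) ^ 2 + (o 1 - x 1) ^ 2 := by
    rw [EuclideanSpace.dist_sq_eq, Fin.sum_univ_two, Real.dist_eq, Real.dist_eq, sq_abs, sq_abs]
  have ha' := sq a
  have hb' := sq b
  have hc' := sq c
  rw [ha] at ha'
  rw [hb] at hb'
  rw [hc] at hc'
  rw [sq d]
  simp only [PiLp.inner_apply, Fin.sum_univ_two, PiLp.sub_apply, RCLike.inner_apply,
    conj_trivial, doubleSignedArea]
  linear_combination (norm := skip) doubleSignedArea d b c * ha' +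
    doubleSignedArea a d c * hb' + doubleSignedArea a b d * hc'
  unfold doubleSignedArea
  ring

lemma mem_affineSpan_pair_of_doubleSignedArea_eq_zero
    {x b c : EuclideanSpace ℝ (Fin 2)} (hbc : b ≠ c) (h : doubleSignedArea x b c = 0) :
    x ∈ affineSpan ℝ {b, c} := by
  have hne : (c 0 - b 0) ^ 2 + (c 1 - b 1) ^ 2 ≠ 0 := by
    intro h0
    apply hbc
    ext i
    fin_cases i <;> simp <;> nlinarith [sq_nonneg (c 0 - b 0), sq_nonneg (c 1 - b 1)]
  rw [mem_affineSpan_pair_iff_exists_lineMap_eq]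
  refine ⟨((x 0 - b 0) * (c 0 - b 0) + (x 1 - b 1) * (c 1 - b 1)) /
    ((c 0 - b 0) ^ 2 + (c 1 - b 1) ^ 2), ?_⟩
  unfold doubleSignedArea at h
  ext i
  fin_cases i <;> simp [AffineMap.lineMap_apply] <;> field_simp
  · linear_combination (c 1 - b 1) * h
  · linear_combination (b 0 - c 0) * h

lemma doubleSignedArea_mul_pos_of_sSameSide
    {a b c d : EuclideanSpace ℝ (Fin 2)} (hbc : b ≠ c)
    (h : (affineSpan ℝ {b, c}).SSameSide a d) :
    0 < doubleSignedArea a b c * doubleSignedArea d b c := by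
  obtain ⟨hw, ha, hd⟩ := h
  obtain ⟨p, hp, q, hq, hpq⟩ := hw
  have hA : doubleSignedArea a b c ≠ 0 :=
    fun h0 => ha (mem_affineSpan_pair_of_doubleSignedArea_eq_zero hbc h0)
  rcases hpq with h0 | h0 | ⟨s, t, hs, ht, hst⟩
  · rw [vsub_eq_zero_iff_eq] at h0
    exact absurd (h0 ▸ hp) ha
  · rw [vsub_eq_zero_iff_eq] at h0
    exact absurd (h0 ▸ hq) hd
  obtain ⟨u, rfl⟩ := mem_affineSpan_pair_iff_exists_lineMap_eq.1 hp
  obtain ⟨v, rfl⟩ := mem_affineSpan_pair_iff_exists_lineMap_eq.1 hq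
  have h0 := congrArg (fun x => x 0) hst
  have h1 := congrArg (fun x => x 1) hst
  simp [AffineMap.lineMap_apply] at h0 h1
  have hprop : s * doubleSignedArea a b c = t * doubleSignedArea d b c := by
    unfold doubleSignedArea
    linear_combination (b 1 - c 1) * h0 + (c 0 - b 0) * h1
  have hpos : 0 < t * (doubleSignedArea a b c * doubleSignedArea d b c) := by
    have : 0 < s * doubleSignedArea a b c ^ 2 := by positivity
    linear_combination this + doubleSignedArea a b c * hprop
  exact pos_of_mul_pos_right hpos ht.le

theorem bw_outside_angle_lt
    (a b c d o : EuclideanSpace ℝ (Fin 2)) (r : ℝ)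
    (ha : dist o a = r) (hb : dist o b = r) (hc : dist o c = r)
    (hbc : b ≠ c)
    (hd : dist o d > r)
    (hside : AffineSubspace.SSameSide (affineSpan ℝ {b, c}) a d) :
    ∠ b d c < ∠ b a c := by
  have hr : 0 ≤ r := ha ▸ dist_nonneg
  have hpow : 0 < dist o d ^ 2 - r ^ 2 := by nlinarith
  have hAD := doubleSignedArea_mul_pos_of_sSameSide hbc hside
  have key := doubleSignedArea_mul_inner_sub_inner_mul_doubleSignedArea (d := d) ha hb hc
  have habs : 0 < |doubleSignedArea a b c| * inner ℝ (b - d) (c - d) -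
      inner ℝ (b - a) (c - a) * |doubleSignedArea d b c| := by
    rcases pos_and_pos_or_neg_and_neg_of_mul_pos hAD with ⟨hA, hD⟩ | ⟨hA, hD⟩
    · rw [abs_of_pos hA, abs_of_pos hD, key]
      positivity
    · rw [abs_of_neg hA, abs_of_neg hD]
      nlinarith
  rw [← sin_angle_mul_dist_mul_dist_eq_abs_doubleSignedArea,
    ← sin_angle_mul_dist_mul_dist_eq_abs_doubleSignedArea,
    ← InnerProductGeometry.cos_angle_mul_norm_mul_norm,
    ← InnerProductGeometry.cos_angle_mul_norm_mul_norm] at habs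
  change 0 < sin (∠ b a c) * (‖b - a‖ * ‖c - a‖) * (cos (∠ b d c) * (‖b - d‖ * ‖c - d‖)) -
    cos (∠ b a c) * (‖b - a‖ * ‖c - a‖) * (sin (∠ b d c) * (‖b - d‖ * ‖c - d‖)) at habs
  have hsin : 0 < sin (∠ b a c - ∠ b d c) := by
    rw [sin_sub]
    refine pos_of_mul_pos_left (b := ‖b - a‖ * ‖c - a‖ * (‖b - d‖ * ‖c - d‖)) ?_ (by positivity)
    linear_combination habs
  by_contra! hle
  have := sin_nonpos_of_nonpos_of_neg_pi_le (x := ∠ b a c - ∠ b d c) (by linarith)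
    (by linarith [angle_nonneg b a c, angle_le_pi b d c])
  linarith
end

section
/- Let p ≥ 1 be an integer and let a, b₀, b₁, …, b_{p+1} be points of the Euclidean plane ℝ² such that for each 0 ≤ i ≤ p the triple (a, b_i, b_{i+1}) is affinely independent. Assume that for every 1 ≤ i ≤ p the two angles at b_i in the adjacent triangles satisfy ∠ a b_i b_{i−1} + ∠ a b_i b_{i+1} > π. Then the total angle at a satisfies ∑_{i=0}^{p} ∠ b_i a b_{i+1} < π. -/
open EuclideanGeometry Real Finset

/-- The angle sum of the triangle spanned by three affinely independent points `x`, `y`, `z`. -/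
lemma angle_sum_of_affineIndependent {x y z : EuclideanSpace ℝ (Fin 2)}
    (h : AffineIndependent ℝ ![x, y, z]) : ∠ y x z + ∠ x y z + ∠ x z y = π := by
  have hne : y ≠ x := fun e => absurd (h.injective (a₁ := 1) (a₂ := 0) (by simpa using e)) (by simp)
  have hsum := EuclideanGeometry.angle_add_angle_add_angle_eq_pi z hne
  rw [EuclideanGeometry.angle_comm y z x, EuclideanGeometry.angle_comm z x y] at hsum
  linarith

/-- A fan of triangles whose two angles at each interior outer vertex add up to more than `π` has
its total apex angle plus its two extreme base angles at most `π`. -/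
lemma fan_angle_add_base_angles_le_pi {p : ℕ}
    {a : EuclideanSpace ℝ (Fin 2)} {b : ℕ → EuclideanSpace ℝ (Fin 2)}
    (hind : ∀ i ≤ p, AffineIndependent ℝ ![a, b i, b (i + 1)])
    (hangles : ∀ i, 1 ≤ i → i ≤ p →
      ∠ a (b i) (b (i - 1)) + ∠ a (b i) (b (i + 1)) > π) :
    ∑ i ∈ Finset.range (p + 1), ∠ (b i) a (b (i + 1))
      + ∠ a (b 0) (b 1) + ∠ a (b (p + 1)) (b p) ≤ π := by
  induction p with
  | zero => simpa using (angle_sum_of_affineIndependent (hind 0 le_rfl)).le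
  | succ n ih =>
    have hprev := ih (fun i hi => hind i (by omega)) (fun i h1 hi => hangles i h1 (by omega))
    have hsum := angle_sum_of_affineIndependent (hind (n + 1) le_rfl)
    have hgt := hangles (n + 1) (by omega) le_rfl
    rw [Nat.add_sub_cancel] at hgt
    rw [Finset.sum_range_succ]
    linarith

theorem fan_total_angle_lt_pi
    (p : ℕ) (hp : 1 ≤ p)
    (a : EuclideanSpace ℝ (Fin 2)) (b : ℕ → EuclideanSpace ℝ (Fin 2))
    (hind : ∀ i ≤ p, AffineIndependent ℝ ![a, b i, b (i + 1)])
    (hangles : ∀ i, 1 ≤ i → i ≤ p →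
      ∠ a (b i) (b (i - 1)) + ∠ a (b i) (b (i + 1)) > π) :
    ∑ i ∈ Finset.range (p + 1), ∠ (b i) a (b (i + 1)) < π := by
  have hle := fan_angle_add_base_angles_le_pi hind hangles
  have hpos : 0 < ∠ a (b 0) (b 1) := EuclideanGeometry.angle_pos_of_not_collinear
    (affineIndependent_iff_not_collinear_set.mp (hind 0 (Nat.zero_le p)))
  have hnonneg := EuclideanGeometry.angle_nonneg a (b (p + 1)) (b p)
  linarith
end

section
/- Let K ⊆ ℝ² be a compact set that is star-convex with respect to a point x lying in the interior of K, and assume that for every nonzero vector v there is exactly one real t > 0 with x + t • v ∈ frontier K (every ray emanating from x meets the frontier of K in exactly one point). Let u, v, w be points of frontier K with convexHull ℝ {u, v, w} ⊆ K, and assume that no three of the four points x, u, v, w are collinear. Then either x ∈ convexHull ℝ {u, v, w}, or the four points x, u, v, w are in convex position, i.e., none of x, u, v, w lies in the convex hull of the other three. -/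
open EuclideanGeometry Real

theorem exists_one_le_add_smul_mem_frontier {E : Type*} [NormedAddCommGroup E] [NormedSpace ℝ E]
    {K : Set E} (hK : Bornology.IsBounded K) {x d : E} (hd : d ≠ 0) (hmem : x + d ∈ K) :
    ∃ t : ℝ, 1 ≤ t ∧ x + t • d ∈ frontier K := by
  have hcont : Continuous fun t : ℝ => x + t • d := by fun_prop
  have hpre : IsPreconnected ((fun t : ℝ => x + t • d) '' Set.Ici 1) :=
    isPreconnected_Ici.image _ hcont.continuousOn
  have hout : ∃ t : ℝ, 1 ≤ t ∧ x + t • d ∉ K := by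
    obtain ⟨R, hR⟩ := hK.exists_norm_le
    by_contra! h
    have hd' : 0 < ‖d‖ := norm_pos_iff.mpr hd
    set t : ℝ := max 1 ((R + ‖x‖ + 1) / ‖d‖)
    have ht1 : 1 ≤ t := le_max_left _ _
    have ht : R + ‖x‖ + 1 ≤ t * ‖d‖ := (div_le_iff₀ hd').mp (le_max_right _ _)
    have hle := hR _ (h t ht1)
    have htri : ‖t • d‖ ≤ ‖x + t • d‖ + ‖x‖ := by
      simpa using norm_sub_le (x + t • d) x
    rw [norm_smul, Real.norm_of_nonneg (by linarith)] at htri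
    linarith
  obtain ⟨t, ht, htK⟩ := hout
  by_contra! h
  have hnot : ∀ y ∈ (fun t : ℝ => x + t • d) '' Set.Ici 1, y ∉ frontier K := by
    rintro _ ⟨s, hs, rfl⟩
    exact h s hs
  have hdichotomy : ∀ y, y ∉ frontier K → y ∈ interior K ∨ y ∈ interior Kᶜ := by
    intro y hy
    rw [interior_compl]
    by_contra! hyK
    exact hy ⟨not_not.mp hyK.2, hyK.1⟩
  have hx1 : x + d ∈ (fun t : ℝ => x + t • d) '' Set.Ici 1 := ⟨1, Set.self_mem_Ici, by simp⟩
  have hxt : x + t • d ∈ (fun t : ℝ => x + t • d) '' Set.Ici 1 := ⟨t, ht, rfl⟩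
  obtain ⟨y, -, hy, hy'⟩ := hpre (interior K) (interior Kᶜ) isOpen_interior isOpen_interior
    (fun y hy => hdichotomy y (hnot y hy))
    ⟨_, hx1, (hdichotomy _ (hnot _ hx1)).resolve_right fun hn => interior_subset hn hmem⟩
    ⟨_, hxt, (hdichotomy _ (hnot _ hxt)).resolve_left fun hn => htK (interior_subset hn)⟩
  exact interior_subset hy' (interior_subset hy)

theorem eq_of_mem_frontier_of_mem_segment {E : Type*} [NormedAddCommGroup E] [NormedSpace ℝ E]
    {K : Set E} (hK : Bornology.IsBounded K) {x : E}
    (hray : ∀ v : E, v ≠ 0 → ∃! t : ℝ, 0 < t ∧ x + t • v ∈ frontier K)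
    {p u : E} (hp : p ∈ K) (hu : u ∈ frontier K) (hux : u ≠ x) (hup : u ∈ segment ℝ x p) :
    u = p := by
  rw [segment_eq_image'] at hup
  obtain ⟨s, ⟨hs0, hs1⟩, rfl⟩ := hup
  have hd : p - x ≠ 0 := by
    intro h
    simp [h] at hux
  have hs : 0 < s := hs0.lt_of_ne (by rintro rfl; simp at hux)
  obtain ⟨t, ht, htK⟩ := exists_one_le_add_smul_mem_frontier hK hd (x := x) (by simpa using hp)
  have hst : s = t := (hray _ hd).unique ⟨hs, hu⟩ ⟨by linarith, htK⟩
  have hs_one : s = 1 := by linarith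
  simp [hs_one]

theorem notMem_convexHull_of_mem_frontier {E : Type*} [NormedAddCommGroup E] [NormedSpace ℝ E]
    {K : Set E} (hK : Bornology.IsBounded K) {x : E}
    (hray : ∀ v : E, v ≠ 0 → ∃! t : ℝ, 0 < t ∧ x + t • v ∈ frontier K)
    {u v w : E} (hu : u ∈ frontier K) (hux : u ≠ x) (hvw : convexHull ℝ {v, w} ⊆ K)
    (hcol : ¬ Collinear ℝ {v, u, w}) : u ∉ convexHull ℝ {x, v, w} := by
  intro h
  rw [convexHull_insert (Set.insert_nonempty _ _), mem_convexJoin] at h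
  obtain ⟨y, rfl, p, hp, hup⟩ := h
  obtain rfl := eq_of_mem_frontier_of_mem_segment hK hray (hvw hp) hu hux hup
  rw [convexHull_pair, mem_segment_iff_wbtw] at hp
  exact hcol hp.collinear

theorem star_convex_triangulation
    (K : Set (EuclideanSpace ℝ (Fin 2))) (x : EuclideanSpace ℝ (Fin 2))
    (hK : IsCompact K)
    (hstar : StarConvex ℝ x K)
    (hx : x ∈ interior K)
    (hray : ∀ v : EuclideanSpace ℝ (Fin 2), v ≠ 0 →
      ∃! t : ℝ, 0 < t ∧ x + t • v ∈ frontier K)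
    (u v w : EuclideanSpace ℝ (Fin 2))
    (hu : u ∈ frontier K) (hv : v ∈ frontier K) (hw : w ∈ frontier K)
    (htri : convexHull ℝ {u, v, w} ⊆ K)
    (h1 : ¬ Collinear ℝ {x, u, v}) (h2 : ¬ Collinear ℝ {x, u, w})
    (h3 : ¬ Collinear ℝ {x, v, w}) (h4 : ¬ Collinear ℝ {u, v, w}) :
    x ∈ convexHull ℝ {u, v, w} ∨
      (x ∉ convexHull ℝ {u, v, w} ∧ u ∉ convexHull ℝ {x, v, w} ∧
       v ∉ convexHull ℝ {x, u, w} ∧ w ∉ convexHull ℝ {x, u, v}) := by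
  refine or_iff_not_imp_left.mpr fun hxin => ⟨hxin, ?_, ?_, ?_⟩
  · refine notMem_convexHull_of_mem_frontier hK.isBounded hray hu ?_
      ((convexHull_mono (by grind)).trans htri) ?_
    · rintro rfl
      exact h1 (by simpa using collinear_pair ℝ u v)
    · rwa [Set.insert_comm]
  · refine notMem_convexHull_of_mem_frontier hK.isBounded hray hv ?_
      ((convexHull_mono (by grind)).trans htri) h4
    rintro rfl
    exact h3 (by simpa using collinear_pair ℝ v w)
  · refine notMem_convexHull_of_mem_frontier hK.isBounded hray hw ?_
      ((convexHull_mono (by grind)).trans htri) ?_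
    · rintro rfl
      exact h3 (by simpa [Set.insert_comm, Set.pair_comm] using collinear_pair ℝ w v)
    · rwa [Set.pair_comm w v]
end

section
/- Let K ⊆ ℝ² be a compact set and let x, y be points of ℝ² with y ∈ frontier K. Assume that t = 1 is the only real number t ≥ 0 such that x + t • (y − x) ∈ frontier K. Then for every real t > 1, the point x + t • (y − x) does not belong to K. -/
open EuclideanGeometry Real

/-- A preconnected set that meets both a set and its complement meets the frontier. -/
theorem IsPreconnected.inter_frontier_nonempty {X : Type*} [TopologicalSpace X]
    {A K : Set X} (hA : IsPreconnected A) (hK : (A ∩ K).Nonempty) (hKc : (A ∩ Kᶜ).Nonempty) :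
    (A ∩ frontier K).Nonempty := by
  by_contra hempty
  have hint : ∀ z ∈ A, z ∈ interior K ∨ z ∈ interior Kᶜ := fun z hz => by
    by_contra! h
    rw [interior_compl, Set.notMem_compl_iff] at h
    exact hempty ⟨z, hz, h.2, h.1⟩
  obtain ⟨a, haA, haK⟩ := hK
  obtain ⟨b, hbA, hbK⟩ := hKc
  obtain ⟨z, -, hz, hz'⟩ := hA _ _ isOpen_interior isOpen_interior hint
    ⟨a, haA, (hint a haA).resolve_right fun h => interior_subset h haK⟩
    ⟨b, hbA, (hint b hbA).resolve_left fun h => hbK (interior_subset h)⟩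
  exact interior_subset hz' (interior_subset hz)

/-- In a real normed space, a ray starting inside a bounded set meets its frontier. -/
theorem exists_mem_frontier_of_mem_of_isBounded {E : Type*} [NormedAddCommGroup E]
    [NormedSpace ℝ E] {K : Set E} (hK : Bornology.IsBounded K) {x v : E} (hv : v ≠ 0) {t : ℝ}
    (ht : x + t • v ∈ K) : ∃ s, t ≤ s ∧ x + s • v ∈ frontier K := by
  have hconn : IsPreconnected ((fun s : ℝ => x + s • v) '' Set.Ici t) :=
    isPreconnected_Ici.image _ (by fun_prop)
  obtain ⟨R, hR⟩ := hK.exists_norm_le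
  have hv' : 0 < ‖v‖ := norm_pos_iff.2 hv
  obtain ⟨s, hts, hs⟩ : ∃ s, t ≤ s ∧ (R + ‖x‖ + 1) / ‖v‖ ≤ s :=
    ⟨_, le_max_left _ _, le_max_right _ _⟩
  have hout : x + s • v ∉ K := fun h => by
    have hle : R + ‖x‖ + 1 ≤ s * ‖v‖ := (div_le_iff₀ hv').1 hs
    have habs : s * ‖v‖ ≤ ‖s • v‖ := by
      rw [norm_smul]
      exact mul_le_mul_of_nonneg_right (le_abs_self s) hv'.le
    have htri : ‖s • v‖ ≤ ‖x + s • v‖ + ‖x‖ := by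
      simpa using norm_sub_le (x + s • v) x
    linarith [hR _ h]
  obtain ⟨_, ⟨r, hr, rfl⟩, hfr⟩ := hconn.inter_frontier_nonempty
    ⟨_, ⟨t, Set.self_mem_Ici, rfl⟩, ht⟩ ⟨_, ⟨s, hts, rfl⟩, hout⟩
  exact ⟨r, hr, hfr⟩

theorem ray_beyond_unique_frontier_point_outside
    (K : Set (EuclideanSpace ℝ (Fin 2))) (x y : EuclideanSpace ℝ (Fin 2))
    (hK : IsCompact K)
    (hy : y ∈ frontier K)
    (huniq : ∀ t : ℝ, 0 ≤ t → x + t • (y - x) ∈ frontier K → t = 1) :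
    ∀ t : ℝ, 1 < t → x + t • (y - x) ∉ K := by
  intro t ht hmem
  have hxy : y - x ≠ 0 := fun h => by
    have hx : x + (0 : ℝ) • (y - x) ∈ frontier K := by simpa [← sub_eq_zero.1 h] using hy
    exact zero_ne_one (huniq 0 le_rfl hx)
  obtain ⟨s, hts, hs⟩ := exists_mem_frontier_of_mem_of_isBounded hK.isBounded hxy hmem
  linarith [huniq s (by linarith) hs]
end

section
/- Let A ⊆ ℝ² be a finite set with no three points collinear, let T be a complete triangulation of A, and let f : ℝ² → ℝ be a nonconstant affine function (so its zero set is a line L). Then any two points a, a′ ∈ A with f(a) > 0 and f(a′) > 0 are connected by a path a = v₀, v₁, …, v_m = a′ in which every pair {v_i, v_{i+1}} is an edge of T and f(v_i) > 0 for every i. Consequently, the vertices and edges of T that lie strictly on one side of L form a connected graph, so the vertices and edges of T disjoint from L form at most two connected components, one on each side of L. -/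
open EuclideanGeometry Real
open scoped Classical

/-- `T` is a complete triangulation of the finite point set `A` in the plane:
its members are affinely independent triples of points of `A`, their convex hulls
cover `convexHull ℝ A`, have pairwise disjoint interiors, meet edge-to-edge, and
every point of `A` is a vertex of some triangle. -/
def IsCompleteTriangulation (A : Finset (EuclideanSpace ℝ (Fin 2)))
    (T : Finset (Finset (EuclideanSpace ℝ (Fin 2)))) : Prop :=
  (∀ σ ∈ T, σ ⊆ A ∧ σ.card = 3 ∧
    AffineIndependent ℝ (fun x : σ => (x : EuclideanSpace ℝ (Fin 2)))) ∧
  (⋃ σ ∈ T, convexHull ℝ (σ : Set (EuclideanSpace ℝ (Fin 2))))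
      = convexHull ℝ (A : Set (EuclideanSpace ℝ (Fin 2))) ∧
  (∀ σ ∈ T, ∀ τ ∈ T, σ ≠ τ →
    Disjoint (interior (convexHull ℝ (σ : Set (EuclideanSpace ℝ (Fin 2)))))
      (interior (convexHull ℝ (τ : Set (EuclideanSpace ℝ (Fin 2)))))) ∧
  (∀ σ ∈ T, ∀ τ ∈ T,
    convexHull ℝ (σ : Set (EuclideanSpace ℝ (Fin 2))) ∩
        convexHull ℝ (τ : Set (EuclideanSpace ℝ (Fin 2)))
      = convexHull ℝ ((σ ∩ τ : Finset (EuclideanSpace ℝ (Fin 2))) :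
          Set (EuclideanSpace ℝ (Fin 2)))) ∧
  (∀ a ∈ A, ∃ σ ∈ T, a ∈ σ)

/-- Points related by the reflexive transitive closure of `r` are joined by an `r`-path. -/
lemma exists_path_of_reflTransGen {α : Type*} {r : α → α → Prop} {a b : α}
    (h : Relation.ReflTransGen r a b) :
    ∃ (m : ℕ) (v : ℕ → α), v 0 = a ∧ v m = b ∧ ∀ i < m, r (v i) (v (i + 1)) := by
  induction h with
  | refl => exact ⟨0, fun _ => a, rfl, rfl, by simp⟩
  | @tail b c _ hbc ih =>
    obtain ⟨m, v, h0, hm, hv⟩ := ih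
    refine ⟨m + 1, fun i => if i ≤ m then v i else c, by simpa using h0, by simp, ?_⟩
    intro i hi
    rcases Nat.lt_succ_iff_lt_or_eq.mp hi with hlt | rfl
    · simpa [hlt.le, Nat.succ_le_of_lt hlt] using hv i hlt
    · simpa [hm] using hbc

/-- An affine function positive somewhere on a convex hull is positive at one of the points
spanning it. -/
lemma exists_pos_of_mem_convexHull {E : Type*} [AddCommGroup E] [Module ℝ E]
    (f : E →ᵃ[ℝ] ℝ) {s : Set E} {x : E} (hx : x ∈ convexHull ℝ s) (hfx : 0 < f x) :
    ∃ v ∈ s, 0 < f v := by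
  by_contra! h
  exact hfx.not_ge (convexHull_min h ((convex_Iic (0 : ℝ)).affine_preimage f) hx)

/-- The graph of a triangulation restricted to an open half-plane: two vertices are adjacent when
they are distinct, lie in the half-plane `0 < f` and belong to a common triangle. -/
def PosAdj (T : Finset (Finset (EuclideanSpace ℝ (Fin 2))))
    (f : EuclideanSpace ℝ (Fin 2) →ᵃ[ℝ] ℝ) (x y : EuclideanSpace ℝ (Fin 2)) : Prop :=
  x ≠ y ∧ 0 < f x ∧ 0 < f y ∧ ∃ σ ∈ T, x ∈ σ ∧ y ∈ σ

/-- Positive vertices of a common triangle are joined in the half-plane graph. -/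
lemma reflTransGen_posAdj_of_mem {T : Finset (Finset (EuclideanSpace ℝ (Fin 2)))}
    {f : EuclideanSpace ℝ (Fin 2) →ᵃ[ℝ] ℝ} {σ : Finset (EuclideanSpace ℝ (Fin 2))}
    (hσ : σ ∈ T) {x y : EuclideanSpace ℝ (Fin 2)} (hx : x ∈ σ) (hy : y ∈ σ)
    (hfx : 0 < f x) (hfy : 0 < f y) : Relation.ReflTransGen (PosAdj T f) x y := by
  rcases eq_or_ne x y with rfl | hne
  · exact .refl
  · exact .single ⟨hne, hfx, hfy, σ, hσ, hx, hy⟩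

/-- The part of a triangulation in an open half-plane is connected: the convex set
`convexHull ℝ A ∩ {0 < f}` would otherwise be separated by the closed unions of the triangles with
a positive vertex inside, respectively outside, one component. -/
lemma IsCompleteTriangulation.reflTransGen_posAdj {A : Finset (EuclideanSpace ℝ (Fin 2))}
    {T : Finset (Finset (EuclideanSpace ℝ (Fin 2)))} (hT : IsCompleteTriangulation A T)
    (f : EuclideanSpace ℝ (Fin 2) →ᵃ[ℝ] ℝ) {a b : EuclideanSpace ℝ (Fin 2)}
    (ha : a ∈ A) (hb : b ∈ A) (hfa : 0 < f a) (hfb : 0 < f b) :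
    Relation.ReflTransGen (PosAdj T f) a b := by
  obtain ⟨-, hcover, -, hedge, hvert⟩ := hT
  by_contra hab
  let region (P : EuclideanSpace ℝ (Fin 2) → Prop) : Set (EuclideanSpace ℝ (Fin 2)) :=
    ⋃ σ ∈ {σ ∈ T | ∃ v ∈ σ, 0 < f v ∧ P v},
      convexHull ℝ (σ : Set (EuclideanSpace ℝ (Fin 2)))
  have mem_region {P : EuclideanSpace ℝ (Fin 2) → Prop} {x : EuclideanSpace ℝ (Fin 2)} :
      x ∈ region P ↔ ∃ σ ∈ T, (∃ v ∈ σ, 0 < f v ∧ P v) ∧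
        x ∈ convexHull ℝ (σ : Set (EuclideanSpace ℝ (Fin 2))) := by
    simp only [region, Set.mem_iUnion, Finset.mem_filter, exists_prop, and_assoc]
  have isClosed_region (P : EuclideanSpace ℝ (Fin 2) → Prop) : IsClosed (region P) :=
    isClosed_biUnion_finset fun σ _ => σ.finite_toSet.isClosed_convexHull ℝ
  let K := convexHull ℝ (A : Set (EuclideanSpace ℝ (Fin 2))) ∩ f ⁻¹' Set.Ioi 0
  have hK : IsPreconnected K :=
    ((convex_convexHull ℝ _).inter ((convex_Ioi (0 : ℝ)).affine_preimage f)).isPreconnected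
  have hKcover : K ⊆ region (Relation.ReflTransGen (PosAdj T f) a) ∪
      region (fun v => ¬ Relation.ReflTransGen (PosAdj T f) a v) := by
    rintro x ⟨hx, hfx⟩
    rw [← hcover] at hx
    simp only [Set.mem_iUnion, exists_prop] at hx
    obtain ⟨σ, hσ, hxσ⟩ := hx
    obtain ⟨v, hv, hfv⟩ := exists_pos_of_mem_convexHull f hxσ hfx
    by_cases h : Relation.ReflTransGen (PosAdj T f) a v
    · exact .inl (mem_region.2 ⟨σ, hσ, ⟨v, hv, hfv, h⟩, hxσ⟩)
    · exact .inr (mem_region.2 ⟨σ, hσ, ⟨v, hv, hfv, h⟩, hxσ⟩)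
  have mem_K_region {P : EuclideanSpace ℝ (Fin 2) → Prop} {c : EuclideanSpace ℝ (Fin 2)}
      (hc : c ∈ A) (hfc : 0 < f c) (hP : P c) : (K ∩ region P).Nonempty := by
    obtain ⟨σ, hσ, hcσ⟩ := hvert c hc
    exact ⟨c, ⟨subset_convexHull ℝ _ hc, hfc⟩,
      mem_region.2 ⟨σ, hσ, ⟨c, hcσ, hfc, hP⟩, subset_convexHull ℝ _ hcσ⟩⟩
  obtain ⟨x, ⟨-, hfx⟩, hx₁, hx₂⟩ := isPreconnected_closed_iff.1 hK _ _ (isClosed_region _)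
    (isClosed_region _) hKcover (mem_K_region ha hfa .refl) (mem_K_region hb hfb hab)
  obtain ⟨σ, hσ, ⟨v, hv, hfv, hav⟩, hxσ⟩ := mem_region.1 hx₁
  obtain ⟨τ, hτ, ⟨u, hu, hfu, hau⟩, hxτ⟩ := mem_region.1 hx₂
  have hxστ := (hedge σ hσ τ hτ).subset ⟨hxσ, hxτ⟩
  obtain ⟨w, hw, hfw⟩ := exists_pos_of_mem_convexHull f hxστ hfx
  obtain ⟨hwσ, hwτ⟩ := Finset.mem_inter.1 (Finset.mem_coe.1 hw)
  exact hau ((hav.trans (reflTransGen_posAdj_of_mem hσ hv hwσ hfv hfw)).trans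
    (reflTransGen_posAdj_of_mem hτ hwτ hu hfw hfu))

theorem splitting_a_triangulation
    (A : Finset (EuclideanSpace ℝ (Fin 2)))
    (hgen : ∀ x ∈ A, ∀ y ∈ A, ∀ z ∈ A, x ≠ y → x ≠ z → y ≠ z →
      ¬ Collinear ℝ ({x, y, z} : Set (EuclideanSpace ℝ (Fin 2))))
    (T : Finset (Finset (EuclideanSpace ℝ (Fin 2))))
    (hT : IsCompleteTriangulation A T)
    (f : EuclideanSpace ℝ (Fin 2) →ᵃ[ℝ] ℝ)
    (hf : ∃ p q, f p ≠ f q) :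
    ∀ a ∈ A, ∀ a' ∈ A, 0 < f a → 0 < f a' →
      ∃ (m : ℕ) (v : ℕ → EuclideanSpace ℝ (Fin 2)),
        v 0 = a ∧ v m = a' ∧
        (∀ i ≤ m, v i ∈ A ∧ 0 < f (v i)) ∧
        (∀ i < m, v i ≠ v (i + 1) ∧ ∃ σ ∈ T, v i ∈ σ ∧ v (i + 1) ∈ σ) := by
  intro a ha a' ha' hfa hfa'
  obtain ⟨m, v, h0, hm, hv⟩ :=
    exists_path_of_reflTransGen (hT.reflTransGen_posAdj f ha ha' hfa hfa')
  refine ⟨m, v, h0, hm, fun i hi => ?_, fun i hi => ⟨(hv i hi).1, (hv i hi).2.2.2⟩⟩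
  rcases hi.lt_or_eq with hlt | rfl
  · obtain ⟨-, hfi, -, σ, hσ, hiσ, -⟩ := hv i hlt
    exact ⟨(hT.1 σ hσ).1 hiσ, hfi⟩
  · exact hm ▸ ⟨ha', hfa'⟩
end

section
/- Let a, b, c, d be points of the Euclidean plane ℝ² such that both triples (a, b, c) and (d, b, c) are affinely independent. If the interiors of convexHull ℝ {a, b, c} and convexHull ℝ {d, b, c} are disjoint, then a and d lie strictly on opposite sides of the line through b and c. -/
open EuclideanGeometry Real

/-- The affine basis of a plane formed by three affinely independent points. -/
noncomputable def triangleAffineBasis {V : Type*} [NormedAddCommGroup V] [NormedSpace ℝ V]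
    [FiniteDimensional ℝ V] (hV : Module.finrank ℝ V = 2) {a b c : V}
    (h : AffineIndependent ℝ ![a, b, c]) : AffineBasis (Fin 3) ℝ V :=
  ⟨![a, b, c], h, h.affineSpan_eq_top_iff_card_eq_finrank_add_one.2 (by simp [hV])⟩

/-- A convex combination of the vertices of a nondegenerate triangle in a plane with positive
weights lies in the interior of the triangle. -/
theorem AffineIndependent.mem_interior_convexHull_triangle {V : Type*} [NormedAddCommGroup V]
    [NormedSpace ℝ V] [FiniteDimensional ℝ V] (hV : Module.finrank ℝ V = 2) {a b c : V}
    (h : AffineIndependent ℝ ![a, b, c]) {u v w : ℝ} (hu : 0 < u) (hv : 0 < v) (hw : 0 < w)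
    (huvw : u + v + w = 1) :
    u • a + v • b + w • c ∈ interior (convexHull ℝ {a, b, c}) := by
  have hsum : ∑ i, ![u, v, w] i = 1 := by simpa [Fin.sum_univ_three] using huvw
  have hrange : Set.range (triangleAffineBasis hV h) = {a, b, c} := by
    change Set.range ![a, b, c] = _
    simp only [Matrix.range_cons, Matrix.range_empty, Set.union_empty, Set.singleton_union]
  have hcomb : Finset.univ.affineCombination ℝ (triangleAffineBasis hV h) ![u, v, w] =
      u • a + v • b + w • c := by
    rw [Finset.affineCombination_eq_linear_combination _ _ _ hsum, Fin.sum_univ_three]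
    rfl
  rw [← hrange, AffineBasis.interior_convexHull, ← hcomb]
  intro i
  rw [AffineBasis.coord_apply_combination_of_mem _ (Finset.mem_univ i) hsum]
  fin_cases i <;> simpa

/-- Every point of a plane is an affine combination of the vertices of a nondegenerate triangle. -/
theorem AffineIndependent.exists_eq_combination_triangle {V : Type*} [NormedAddCommGroup V]
    [NormedSpace ℝ V] [FiniteDimensional ℝ V] (hV : Module.finrank ℝ V = 2) {a b c : V}
    (h : AffineIndependent ℝ ![a, b, c]) (x : V) :
    ∃ u v w : ℝ, u + v + w = 1 ∧ x = u • a + v • b + w • c := by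
  have hsum := (triangleAffineBasis hV h).sum_coord_apply_eq_one x
  have hx := (triangleAffineBasis hV h).linear_combination_coord_eq_self x
  rw [Fin.sum_univ_three] at hsum hx
  exact ⟨_, _, _, hsum, hx.symm⟩

/-- The first vertex of a nondegenerate triangle is not on the line through the other two. -/
theorem AffineIndependent.notMem_affineSpan_pair {V : Type*} [AddCommGroup V] [Module ℝ V]
    {a b c : V} (h : AffineIndependent ℝ ![a, b, c]) : a ∉ affineSpan ℝ {b, c} :=
  fun ha ↦ affineIndependent_iff_not_collinear_set.1 h
    (collinear_insert_of_mem_affineSpan_pair ha)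

theorem disjoint_interiors_opposite_sides
    (a b c d : EuclideanSpace ℝ (Fin 2))
    (habc : AffineIndependent ℝ ![a, b, c])
    (hdbc : AffineIndependent ℝ ![d, b, c])
    (hdisj : Disjoint
      (interior (convexHull ℝ ({a, b, c} : Set (EuclideanSpace ℝ (Fin 2)))))
      (interior (convexHull ℝ ({d, b, c} : Set (EuclideanSpace ℝ (Fin 2)))))) :
    AffineSubspace.SOppSide (affineSpan ℝ {b, c}) a d := by
  have hV : Module.finrank ℝ (EuclideanSpace ℝ (Fin 2)) = 2 := by simp
  obtain ⟨u, v, w, hsum, hd⟩ := habc.exists_eq_combination_triangle hV d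
  have hline : d = u • (a -ᵥ b) +ᵥ AffineMap.lineMap b c w := by
    obtain rfl : v = 1 - u - w := by linarith
    rw [hd, AffineMap.lineMap_apply_module, vsub_eq_sub, vadd_eq_add]
    module
  rcases lt_trichotomy u 0 with hu | hu | hu
  · rw [hline]
    exact AffineSubspace.sOppSide_smul_vsub_vadd_right habc.notMem_affineSpan_pair
      (left_mem_affineSpan_pair ℝ b c) (AffineMap.lineMap_mem_affineSpan_pair w b c) hu
  · refine absurd ?_ hdbc.notMem_affineSpan_pair
    rw [hline, hu, zero_smul, zero_vadd]
    exact AffineMap.lineMap_mem_affineSpan_pair w b c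
  · -- Close enough to the midpoint of `bc`, the segment towards `d` lies in both interiors.
    exfalso
    obtain ⟨s, hs, hs1⟩ : ∃ s : ℝ, 0 < s ∧ s * (3 + 2 * |v| + 2 * |w|) = 1 :=
      ⟨(3 + 2 * |v| + 2 * |w|)⁻¹, by positivity, inv_mul_cancel₀ (by positivity)⟩
    have hsv : 0 ≤ s * |v| := by positivity
    have hsw : 0 ≤ s * |w| := by positivity
    have hv : -(s * |v|) ≤ s * v := by nlinarith [neg_abs_le v]
    have hw : -(s * |w|) ≤ s * w := by nlinarith [neg_abs_le w]
    have h₁ := habc.mem_interior_convexHull_triangle hV (u := s * u) (v := s * v + (1 - s) / 2)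
      (w := s * w + (1 - s) / 2) (by positivity) (by linarith) (by linarith)
      (by linear_combination s * hsum)
    have h₂ := hdbc.mem_interior_convexHull_triangle hV (u := s) (v := (1 - s) / 2)
      (w := (1 - s) / 2) hs (by linarith) (by linarith) (by ring)
    refine Set.disjoint_left.1 hdisj h₁ ?_
    convert h₂ using 1
    rw [hd]
    module
end

section
/- Let k > 0 be a real number, let s, a, b, c, d be points of ℝ² with b ≠ c, and set u = k⁻¹ • (s + a + b), v = k⁻¹ • (s + a + c), w = k⁻¹ • (s + b + c), z = k⁻¹ • (s + a + d). Then w and z lie strictly on opposite sides of the line through u and v if and only if a and d lie strictly on the same side of the line through b and c. -/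
open EuclideanGeometry Real

/-- Reflecting a point through a point of an affine subspace moves it to the other side. -/
theorem AffineSubspace.sOppSide_pointReflection_left_iff {V P : Type*} [AddCommGroup V]
    [Module ℝ V] [AddTorsor V P] {S : AffineSubspace ℝ P} {m x y : P} (hm : m ∈ S) :
    S.SOppSide (AffineEquiv.pointReflection ℝ m x) y ↔ S.SSameSide x y := by
  constructor
  · intro h
    have hx : x ∉ S := fun hx => h.left_notMem <| by
      rw [AffineEquiv.pointReflection_apply]
      exact vadd_mem_of_mem_direction (vsub_mem_direction hm hx) hm
    exact (sOppSide_pointReflection hm hx).trans h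
  · intro h
    exact (sOppSide_pointReflection hm h.left_notMem).symm.trans_sSameSide h

theorem homothetic_sides_iff
    (k : ℝ) (hk : 0 < k)
    (s a b c d : EuclideanSpace ℝ (Fin 2)) (hbc : b ≠ c) :
    AffineSubspace.SOppSide
        (affineSpan ℝ {k⁻¹ • (s + a + b), k⁻¹ • (s + a + c)})
        (k⁻¹ • (s + b + c)) (k⁻¹ • (s + a + d))
      ↔ AffineSubspace.SSameSide (affineSpan ℝ {b, c}) a d := by
  let f : EuclideanSpace ℝ (Fin 2) ≃ᵃ[ℝ] EuclideanSpace ℝ (Fin 2) :=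
    (AffineEquiv.constVAdd ℝ _ (s + a)).trans
      (LinearEquiv.smulOfNeZero ℝ _ k⁻¹ (inv_ne_zero hk.ne')).toAffineEquiv
  have hf (x : EuclideanSpace ℝ (Fin 2)) : f x = k⁻¹ • (s + a + x) := rfl
  have hw : k⁻¹ • (s + b + c) = f (AffineEquiv.pointReflection ℝ (midpoint ℝ b c) a) := by
    rw [hf, AffineEquiv.pointReflection_apply, midpoint_eq_smul_add, invOf_eq_inv, vsub_eq_sub, vadd_eq_add]
    module
  have hS : affineSpan ℝ {f b, f c} = (affineSpan ℝ {b, c}).map f.toAffineMap := by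
    rw [AffineSubspace.map_span, Set.image_pair]
    rfl
  rw [hw, ← hf b, ← hf c, ← hf d, hS]
  exact f.sOppSide_map_iff.trans
    (AffineSubspace.sOppSide_pointReflection_left_iff (AffineMap.lineMap_mem_affineSpan_pair _ b c))
end
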